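/- arXiv:0906.1916 — 5 statements merged into one kernel-verified Lean document; each statement's English description precedes it below -/
import Mathlib

section
/- Let (X,d) be a metric space. For each p ∈ X define i_p(x,y) = d(x,y)/(d(x,p)·d(y,p)) for x, y ∈ X \ {p}. Then i_p satisfies the triangle inequality on X \ {p} for every p ∈ X (equivalently, (X \ {p}, i_p) is a metric space for every p ∈ X) if and only if (X,d) is Ptolemaic, i.e. d(x,y)·d(z,p) ≤ d(x,z)·d(p,y) + d(x,p)·d(y,z) for all x, y, z, p ∈ X. -/
/-- Clearing denominators in the triangle inequality for an inversion semimetric. -/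
theorem div_mul_le_div_mul_add_div_mul_iff {a b c u v w : ℝ}
    (ha : 0 < a) (hb : 0 < b) (hc : 0 < c) :
    u / (a * c) ≤ v / (a * b) + w / (b * c) ↔ u * b ≤ v * c + w * a := by
  have hl : u / (a * c) = u * b / (a * b * c) := by field_simp
  have hr : v / (a * b) + w / (b * c) = (v * c + w * a) / (a * b * c) := by field_simp
  rw [hl, hr, div_le_div_iff_of_pos_right (by positivity)]

/-- The inversion semimetric `i_p(x,y) = d(x,y)/(d(x,p)·d(y,p))` satisfies the
triangle inequality on `X \ {p}` for every `p` if and only if `(X,d)` is Ptolemaic. -/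
theorem inversion_metric_iff_ptolemaic {X : Type*} [MetricSpace X] :
    (∀ p x y z : X, x ≠ p → y ≠ p → z ≠ p →
        dist x z / (dist x p * dist z p) ≤
          dist x y / (dist x p * dist y p) + dist y z / (dist y p * dist z p)) ↔
    (∀ x y z p : X, dist x y * dist z p ≤ dist x z * dist p y + dist x p * dist y z) := by
  constructor
  · intro h x y z p
    rcases eq_or_ne x p with rfl | hx
    · simp [dist_comm z x, mul_comm]
    rcases eq_or_ne y p with rfl | hy
    · simp [dist_comm z y]
    rcases eq_or_ne z p with rfl | hz
    · rw [dist_self, mul_zero]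
      positivity
    have := (div_mul_le_div_mul_add_div_mul_iff (dist_pos.2 hx) (dist_pos.2 hz)
      (dist_pos.2 hy)).1 (h p x z y hx hz hy)
    rwa [dist_comm p y, dist_comm y z, mul_comm (dist x p)]
  · intro h p x y z hx hy hz
    rw [div_mul_le_div_mul_add_div_mul_iff (dist_pos.2 hx) (dist_pos.2 hy) (dist_pos.2 hz)]
    have := h x z y p
    rwa [dist_comm p z, dist_comm z y, mul_comm (dist x p)] at this
end

section
/- Let (X,d) be a Ptolemaic metric space and let L > 0. Then there is no isometric embedding of the circle of circumference L (that is, ℝ/Lℤ equipped with the arc-length metric dist(a,b) = min over representatives of |a−b|) into X; i.e., there is no map f : ℝ/Lℤ → X with d(f(a), f(b)) = dist(a,b) for all a, b. In particular, a Ptolemaic metric space contains no isometrically embedded circle: the four quarter points of such a circle would violate the Ptolemy inequality. -/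
theorem AddCircle.dist_coe_eq_abs_sub {L : ℝ} (hL : 0 < L) {s t : ℝ} (h : |s - t| ≤ L / 2) :
    dist (s : AddCircle L) (t : AddCircle L) = |s - t| := by
  rw [dist_eq_norm, ← AddCircle.coe_sub, AddCircle.norm_coe_eq_abs_iff L hL.ne', abs_of_pos hL]
  exact h

/-- A Ptolemaic metric space contains no isometrically embedded circle:
there is no map from `ℝ/Lℤ` (with the arc-length metric) into `X` preserving distances. -/
theorem ptolemaic_no_embedded_circle {X : Type*} [MetricSpace X]
    (hPtol : ∀ x y z p : X, dist x y * dist z p ≤ dist x z * dist p y + dist x p * dist y z)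
    (L : ℝ) (hL : 0 < L) :
    ¬ ∃ f : AddCircle L → X, ∀ a b : AddCircle L, dist (f a) (f b) = dist a b := by
  rintro ⟨f, hf⟩
  have hdist {s t : ℝ} (r : ℝ) (hst : t - s = r) (h0 : 0 ≤ r) (hr : r ≤ L / 2) :
      dist (f (s : AddCircle L)) (f (t : AddCircle L)) = r := by
    have habs : |s - t| = r := by rw [abs_sub_comm, hst, abs_of_nonneg h0]
    rw [hf, AddCircle.dist_coe_eq_abs_sub hL (habs.trans_le hr), habs]
  have hperiod : ((L : ℝ) : AddCircle L) = ((0 : ℝ) : AddCircle L) := by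
    simp [AddCircle.coe_period]
  have h := hPtol (f ((0 : ℝ) : AddCircle L)) (f ((L / 2 : ℝ) : AddCircle L))
    (f ((L / 4 : ℝ) : AddCircle L)) (f ((3 * L / 4 : ℝ) : AddCircle L))
  have hxp : dist (f ((0 : ℝ) : AddCircle L)) (f ((3 * L / 4 : ℝ) : AddCircle L)) = L / 4 := by
    rw [← hperiod, dist_comm]
    exact hdist _ (by ring) (by linarith) (by linarith)
  rw [hxp, dist_comm (f ((3 * L / 4 : ℝ) : AddCircle L)),
    dist_comm (f ((L / 2 : ℝ) : AddCircle L)) (f ((L / 4 : ℝ) : AddCircle L)),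
    hdist (L / 2) (by ring) (by linarith) le_rfl,
    hdist (L / 2) (by ring) (by linarith) le_rfl,
    hdist (L / 4) (by ring) (by linarith) (by linarith),
    hdist (L / 4) (by ring) (by linarith) (by linarith),
    hdist (L / 4) (by ring) (by linarith) (by linarith)] at h
  nlinarith [mul_pos hL hL]
end

section
/- Let D ∈ (0, π/2) and choose λ with √2 < λ < √(2(1 + cos D)). Then there exists ε₀ > 0 (depending on λ and D) such that for all ε with 0 < ε < ε₀: arccos(1 − ε·(1 − cos 2D)) > λ·arccos(1 − ε·(1 − cos D)). -/
open Real

/-- If `lam ^ 2 < k`, then scaling the deficit `1 - y` by `k` increases `arccos` by more than the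
factor `lam`, provided `y` is close enough to `1`. -/
theorem mul_arccos_one_sub_lt {lam k x : ℝ} (hlam₀ : 0 ≤ lam) (hlam : lam ≤ 2)
    (hlamk : lam ^ 2 < k) (hx₀ : 0 < x) (hx : 5 * k * x < k - lam ^ 2) (hkx : k * x ≤ 2) :
    lam * arccos (1 - x) < arccos (1 - k * x) := by
  have hk : 0 < k := (sq_nonneg lam).trans_lt hlamk
  have hx₁ : 5 * x < 1 := by nlinarith [sq_nonneg lam]
  set θ := arccos (1 - x) with hθ
  have hcos : cos θ = 1 - x := cos_arccos (by linarith) (by linarith)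
  have hθ₀ : 0 < θ := arccos_pos.2 (by linarith)
  have hθπ : |θ| ≤ π := by rw [abs_of_pos hθ₀]; exact arccos_le_pi _
  have hπ : π ^ 2 ≤ 10 := by nlinarith [pi_lt_d2, pi_pos]
  have hθsq : θ ^ 2 ≤ 5 * x := by
    have h := cos_le_one_sub_mul_cos_sq hθπ
    rw [hcos] at h
    have h' : 2 / π ^ 2 * θ ^ 2 ≤ x := by linarith
    rw [div_mul_eq_mul_div, div_le_iff₀ (by positivity)] at h'
    nlinarith
  have hθ₁ : θ ≤ 1 := by nlinarith
  have hx_lower : θ ^ 2 / 2 - θ ^ 4 * (5 / 96) ≤ x := by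
    have h := (abs_le.1 (cos_bound (x := θ) (by rwa [abs_of_pos hθ₀]))).2
    rw [hcos, abs_of_pos hθ₀] at h
    linarith
  have hlt : lam ^ 2 * θ ^ 2 / 2 < k * x := by
    have hkθ : k * θ ^ 2 < k - lam ^ 2 := by nlinarith
    have h₁ := mul_le_mul_of_nonneg_left hx_lower hk.le
    have h₂ := mul_lt_mul_of_pos_right hkθ (pow_pos hθ₀ 2)
    have h₃ : 0 < k * θ ^ 4 := by positivity
    nlinarith
  have hcos_lt : 1 - k * x < cos (lam * θ) := by
    have h := one_sub_sq_div_two_le_cos (x := lam * θ)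
    rw [mul_pow] at h
    linarith
  have hle : lam * θ ≤ π := by nlinarith [pi_gt_three]
  rw [← arccos_cos (by positivity) hle]
  exact arccos_lt_arccos (by linarith) hcos_lt (cos_le_one _)

/-- Lemma 3.2: For `D ∈ (0, π/2)` and `√2 < λ < √(2(1 + cos D))`, for all
sufficiently small `ε > 0`:
`arccos (1 - ε(1 - cos 2D)) > λ · arccos (1 - ε(1 - cos D))`. -/
theorem arccos_comparison (D : ℝ) (hD : D ∈ Set.Ioo 0 (π / 2)) (lam : ℝ)
    (hlam₁ : Real.sqrt 2 < lam) (hlam₂ : lam < Real.sqrt (2 * (1 + cos D))) :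
    ∃ ε₀ > (0 : ℝ), ∀ ε : ℝ, 0 < ε → ε < ε₀ →
      arccos (1 - ε * (1 - cos (2 * D))) > lam * arccos (1 - ε * (1 - cos D)) := by
  obtain ⟨hD₀, hD₁⟩ := hD
  have hc₀ : 0 < cos D := cos_pos_of_mem_Ioo ⟨by linarith, hD₁⟩
  have hc₁ : cos D < 1 := by
    simpa using cos_lt_cos_of_nonneg_of_le_pi_div_two le_rfl hD₁.le hD₀
  have hlam₀ : 0 < lam := (sqrt_nonneg 2).trans_lt hlam₁
  have hlamk : lam ^ 2 < 2 * (1 + cos D) := (lt_sqrt hlam₀.le).1 hlam₂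
  have hk : 0 < 5 * (2 * (1 + cos D)) := by positivity
  refine ⟨(2 * (1 + cos D) - lam ^ 2) / (5 * (2 * (1 + cos D))),
    div_pos (by linarith) hk, fun ε hε hε₀ => ?_⟩
  rw [lt_div_iff₀ hk] at hε₀
  have hdouble : ε * (1 - cos (2 * D)) = 2 * (1 + cos D) * (ε * (1 - cos D)) := by
    rw [cos_two_mul]; ring
  have hle : 5 * (2 * (1 + cos D)) * (ε * (1 - cos D)) ≤ ε * (5 * (2 * (1 + cos D))) := by
    have : 0 < 5 * (2 * (1 + cos D)) * ε * cos D := by positivity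
    linarith
  rw [hdouble]
  exact mul_arccos_one_sub_lt hlam₀.le (by nlinarith) hlamk
    (mul_pos hε (by linarith)) (by linarith) (by nlinarith)
end

section
/- Let D ∈ (0, π/2) and λ ∈ (√2, √(2(1 + cos D))). Then there exists ε₀ > 0 such that for all ε ∈ (0, ε₀): (1 − cos 2D)/√(2ε(1 − cos 2D) − ε²(1 − cos 2D)²) > λ·(1 − cos D)/√(2ε(1 − cos D) − ε²(1 − cos D)²). (The two sides are, respectively, the derivatives with respect to ε of arccos(1 − ε(1 − cos 2D)) and of λ·arccos(1 − ε(1 − cos D)).) -/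
open Real

/-- If `2 < lam ^ 2 < b / a`, the quotients `b / √(2εb - ε²b²)` and `lam * a / √(2εa - ε²a²)`
are strictly ordered wherever both radicands are positive. -/
lemma mul_div_sqrt_lt_div_sqrt {a b lam ε : ℝ} (ha : 0 < a) (hb : 0 < b) (hε : 0 < ε)
    (hεa : ε * a < 2) (hεb : ε * b < 2) (hlam : 2 < lam ^ 2) (hab : lam ^ 2 * a < b) :
    lam * a / √(2 * ε * a - ε ^ 2 * a ^ 2) < b / √(2 * ε * b - ε ^ 2 * b ^ 2) := by
  have hA : 0 < 2 * ε * a - ε ^ 2 * a ^ 2 := by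
    nlinarith [mul_pos (mul_pos hε ha) (sub_pos.2 hεa)]
  have hB : 0 < 2 * ε * b - ε ^ 2 * b ^ 2 := by
    nlinarith [mul_pos (mul_pos hε hb) (sub_pos.2 hεb)]
  have key : lam ^ 2 * a * (2 - ε * b) < b * (2 - ε * a) := by
    nlinarith [mul_pos (mul_pos (mul_pos hε ha) hb) (show 0 < lam ^ 2 - 1 by linarith)]
  rw [div_lt_div_iff₀ (sqrt_pos.2 hA) (sqrt_pos.2 hB)]
  refine lt_of_pow_lt_pow_left₀ 2 (by positivity) ?_
  rw [mul_pow, mul_pow b, sq_sqrt hA.le, sq_sqrt hB.le]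
  linear_combination (ε * a * b) * key

/-- Comparison of the derivatives of `arccos (1 - ε(1 - cos 2D))` and
`λ · arccos (1 - ε(1 - cos D))` for small `ε > 0`. -/
theorem derivative_comparison (D : ℝ) (hD : D ∈ Set.Ioo 0 (π / 2)) (lam : ℝ)
    (hlam₁ : Real.sqrt 2 < lam) (hlam₂ : lam < Real.sqrt (2 * (1 + cos D))) :
    ∃ ε₀ > (0 : ℝ), ∀ ε : ℝ, 0 < ε → ε < ε₀ →
      (1 - cos (2 * D)) /
          Real.sqrt (2 * ε * (1 - cos (2 * D)) - ε ^ 2 * (1 - cos (2 * D)) ^ 2) >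
        lam * (1 - cos D) /
          Real.sqrt (2 * ε * (1 - cos D) - ε ^ 2 * (1 - cos D) ^ 2) := by
  have hlam : 0 < lam := (sqrt_nonneg 2).trans_lt hlam₁
  have hc : 0 < cos D := cos_pos_of_mem_Ioo ⟨by linarith [hD.1, pi_pos], hD.2⟩
  have ha : 0 < 1 - cos D := by
    have := cos_lt_cos_of_nonneg_of_le_pi_div_two le_rfl hD.2.le hD.1
    rw [cos_zero] at this
    linarith
  have hb : 1 - cos (2 * D) = 2 * (1 + cos D) * (1 - cos D) := by rw [cos_two_mul]; ring
  have hb_pos : 0 < 1 - cos (2 * D) := by rw [hb]; positivity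
  have hb_le : 1 - cos (2 * D) ≤ 2 := by linarith [neg_one_le_cos (2 * D)]
  refine ⟨1, one_pos, fun ε hε hε₁ => mul_div_sqrt_lt_div_sqrt ha hb_pos hε ?_ ?_ ?_ ?_⟩
  · nlinarith
  · nlinarith
  · exact (sqrt_lt' hlam).1 hlam₁
  · rw [hb]
    exact mul_lt_mul_of_pos_right ((lt_sqrt hlam.le).1 hlam₂) ha
end

section
/- Let κ < 0, let D ∈ (0, π/2), and let r be a natural number. For ε > 0 define D'(ε) = arccos(1 − sin^{2r}(ε)·(1 − cos D)), D''(ε) = arccos(1 − sin^{2r}(ε)·(1 − cos 2D)), S'(ε) = (2/√(−κ))·arsinh(sin(D'(ε)/2)·sinh(√(−κ)·ε)) and S''(ε) = (2/√(−κ))·arsinh(sin(D''(ε)/2)·sinh(√(−κ)·ε)). Then there exists ε₀ > 0 such that for all ε ∈ (0, ε₀): S''(ε)² > 2·S'(ε)². Consequently, the Ptolemy inequality fails for four points whose four adjacent distances equal S'(ε) and whose two diagonal distances equal S''(ε). -/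
open Real

open Filter Topology in
lemma eventually_sqrt_two_mul_arsinh_lt {a b : ℝ} (h : √2 * b < a) :
    ∀ᶠ x in 𝓝[>] (0 : ℝ), √2 * arsinh (b * x) < arsinh (a * x) := by
  have key (c : ℝ) : HasDerivAt (fun x : ℝ => arsinh (c * x)) c 0 := by
    simpa using ((hasDerivAt_id (0 : ℝ)).const_mul c).arsinh
  have hd := (key a).sub ((key b).const_mul (√2))
  have hs := (hasDerivAt_iff_tendsto_slope.mp hd).mono_left
    (nhdsWithin_mono 0 fun x (hx : 0 < x) => hx.ne')
  filter_upwards [hs.eventually (lt_mem_nhds (sub_pos.mpr h)), self_mem_nhdsWithin]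
    with x hx hx0
  have hx0 : 0 < x := hx0
  simpa [slope_def_field, div_pos_iff_of_pos_right, hx0] using hx

/-- The half-angle sine of the angle produced by `r` iterated unit spherical cones. -/
lemma sin_half_arccos_one_sub_pow_mul {t θ : ℝ} (ht : 0 ≤ t) (ht' : t ≤ 1) (hθ : 0 ≤ θ)
    (hθ' : θ ≤ 2 * π) (r : ℕ) :
    sin (arccos (1 - t ^ (2 * r) * (1 - cos θ)) / 2) = t ^ r * sin (θ / 2) := by
  have h0 : 0 ≤ t ^ (2 * r) := pow_nonneg ht _
  have h1 : t ^ (2 * r) ≤ 1 := pow_le_one₀ ht ht'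
  have hc := cos_le_one θ
  have hc' := neg_one_le_cos θ
  rw [sin_half_eq_sqrt (arccos_nonneg _)
      (by linarith [arccos_le_pi (1 - t ^ (2 * r) * (1 - cos θ)), pi_pos]),
    cos_arccos (by nlinarith) (by nlinarith), sin_half_eq_sqrt hθ hθ',
    show (1 - (1 - t ^ (2 * r) * (1 - cos θ))) / 2 = (t ^ r) ^ 2 * ((1 - cos θ) / 2) by ring,
    sqrt_mul (sq_nonneg _), sqrt_sq (pow_nonneg ht r)]

lemma sqrt_two_mul_sin_half_lt_sin {θ : ℝ} (hθ : 0 < θ) (hθ' : θ < π / 2) :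
    √2 * sin (θ / 2) < sin θ := by
  have hs : 0 < sin (θ / 2) := sin_pos_of_pos_of_lt_pi (by linarith) (by linarith)
  have hc : √2 / 2 < cos (θ / 2) := by
    rw [← cos_pi_div_four]
    exact cos_lt_cos_of_nonneg_of_le_pi (by linarith) (by linarith [pi_pos]) (by linarith)
  have hd : sin θ = 2 * sin (θ / 2) * cos (θ / 2) := by rw [← sin_two_mul]; ring_nf
  nlinarith

/-- In the hyperbolic (`κ < 0`) case, with
`D'(ε) = arccos (1 - sin^(2r) ε (1 - cos D))`, `D''(ε) = arccos (1 - sin^(2r) ε (1 - cos 2D))`,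
`S'(ε) = (2/√(-κ))·arsinh(sin(D'(ε)/2)·sinh(√(-κ)·ε))` and
`S''(ε) = (2/√(-κ))·arsinh(sin(D''(ε)/2)·sinh(√(-κ)·ε))`, for all sufficiently small `ε > 0`
one has `S''(ε)² > 2·S'(ε)²`, so the Ptolemy inequality fails for the four quarter points. -/
theorem quarter_points_violate_ptolemy_hyperbolic (κ : ℝ) (hκ : κ < 0)
    (D : ℝ) (hD : D ∈ Set.Ioo 0 (π / 2)) (r : ℕ) :
    ∃ ε₀ > (0 : ℝ), ∀ ε : ℝ, 0 < ε → ε < ε₀ →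
      (2 / Real.sqrt (-κ) *
          arsinh (sin (arccos (1 - sin ε ^ (2 * r) * (1 - cos (2 * D))) / 2) *
            Real.sinh (Real.sqrt (-κ) * ε))) ^ 2 >
        2 * (2 / Real.sqrt (-κ) *
          arsinh (sin (arccos (1 - sin ε ^ (2 * r) * (1 - cos D)) / 2) *
            Real.sinh (Real.sqrt (-κ) * ε))) ^ 2 := by
  obtain ⟨hD0, hD1⟩ := hD
  have hk : 0 < √(-κ) := sqrt_pos.mpr (neg_pos.mpr hκ)
  have hu : Filter.Tendsto (fun ε : ℝ => sin ε ^ r * Real.sinh (√(-κ) * ε))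
      (nhdsWithin 0 (Set.Ioi 0)) (nhdsWithin 0 (Set.Ioi 0)) := by
    refine tendsto_nhdsWithin_iff.mpr ⟨?_, ?_⟩
    · have hcont : Continuous fun ε : ℝ => sin ε ^ r * Real.sinh (√(-κ) * ε) := by fun_prop
      simpa using (hcont.tendsto 0).mono_left nhdsWithin_le_nhds
    · filter_upwards [Ioo_mem_nhdsGT pi_pos] with ε hε
      exact mul_pos (pow_pos (sin_pos_of_mem_Ioo hε) r) (Real.sinh_pos_iff.mpr (mul_pos hk hε.1))
  have hev := hu.eventually
    (eventually_sqrt_two_mul_arsinh_lt (sqrt_two_mul_sin_half_lt_sin hD0 hD1))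
  obtain ⟨δ, hδ, hlt⟩ := mem_nhdsGT_iff_exists_Ioo_subset.mp hev
  refine ⟨min δ π, lt_min hδ pi_pos, fun ε hε hε' => ?_⟩
  have hsin : 0 < sin ε := sin_pos_of_pos_of_lt_pi hε (hε'.trans_le (min_le_right _ _))
  have harsinh := hlt ⟨hε, hε'.trans_le (min_le_left _ _)⟩
  rw [Set.mem_ofPred_eq] at harsinh
  rw [sin_half_arccos_one_sub_pow_mul hsin.le (sin_le_one ε) (by linarith) (by linarith),
    sin_half_arccos_one_sub_pow_mul hsin.le (sin_le_one ε) hD0.le (by linarith),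
    mul_div_cancel_left₀ D two_ne_zero, mul_right_comm, mul_right_comm _ (sin (D / 2)),
    mul_comm _ (sin D), mul_comm _ (sin (D / 2)), mul_pow, mul_pow, gt_iff_lt, mul_left_comm]
  have hnonneg : 0 ≤ √2 * arsinh (sin (D / 2) * (sin ε ^ r * Real.sinh (√(-κ) * ε))) := by
    refine mul_nonneg (sqrt_nonneg 2) (arsinh_nonneg_iff.mpr (mul_nonneg ?_ ?_))
    · exact (sin_pos_of_pos_of_lt_pi (by linarith) (by linarith)).le
    · exact mul_nonneg (pow_nonneg hsin.le r) (Real.sinh_nonneg_iff.mpr (mul_pos hk hε).le)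
  have hsq := pow_lt_pow_left₀ harsinh hnonneg two_ne_zero
  rw [mul_pow, sq_sqrt zero_le_two] at hsq
  exact mul_lt_mul_of_pos_left hsq (by positivity)
end
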